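/- arXiv:2102.00296 — 3 statements merged into one kernel-verified Lean document; each statement's English description precedes it below -/
import Mathlib

section
/- For any infinite Hausdorff space X, the following are equivalent: (a) X satisfies S_1(Ω,Ω); (b) P_fin(X) satisfies S_1(Ω,Ω); (c) P_fin(X) is Rothberger. -/
open Set

section Covers

variable (Y : Type*) [TopologicalSpace Y]

/-- The collection `𝒯_Y` of proper nonempty open subsets of `Y`. -/
def ProperNonemptyOpens : Set (Set Y) :=
  {U | IsOpen U ∧ U.Nonempty ∧ U ≠ Set.univ}

/-- A non-trivial open cover: an open cover not containing the whole space. -/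
def IsNontrivialOpenCover (𝒰 : Set (Set Y)) : Prop :=
  (∀ U ∈ 𝒰, IsOpen U) ∧ ⋃₀ 𝒰 = Set.univ ∧ Set.univ ∉ 𝒰

/-- An ω-cover: a non-trivial open cover such that every finite subset of the
space is contained in some member. -/
def IsOmegaCover (𝒰 : Set (Set Y)) : Prop :=
  IsNontrivialOpenCover Y 𝒰 ∧ ∀ F : Set Y, F.Finite → ∃ U ∈ 𝒰, F ⊆ U

/-- A k-cover: a non-trivial open cover such that every compact proper subset of
the space is contained in some member. -/
def IsKCover (𝒰 : Set (Set Y)) : Prop :=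
  IsNontrivialOpenCover Y 𝒰 ∧ ∀ K : Set Y, IsCompact K → K ≠ Set.univ → ∃ U ∈ 𝒰, K ⊆ U

/-- An `𝒜`-cover: a non-trivial open cover such that every `A ∈ 𝒜` is contained
in some member. -/
def IsACover (𝒜 𝒰 : Set (Set Y)) : Prop :=
  IsNontrivialOpenCover Y 𝒰 ∧ ∀ A ∈ 𝒜, ∃ U ∈ 𝒰, A ⊆ U

/-- `O_Y`: the collection of non-trivial open covers of `Y`. -/
def openCovers : Set (Set (Set Y)) := {𝒰 | IsNontrivialOpenCover Y 𝒰}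

/-- `Ω_Y`: the collection of ω-covers of `Y`. -/
def omegaCovers : Set (Set (Set Y)) := {𝒰 | IsOmegaCover Y 𝒰}

/-- `K_Y`: the collection of k-covers of `Y`. -/
def kCovers : Set (Set (Set Y)) := {𝒰 | IsKCover Y 𝒰}

/-- `O(Y,𝒜)`: the collection of `𝒜`-covers of `Y`. -/
def aCovers (𝒜 : Set (Set Y)) : Set (Set (Set Y)) := {𝒰 | IsACover Y 𝒜 𝒰}

/-- Lindelöf: every open cover has a countable subcover. -/
def IsLindelofSp : Prop :=
  ∀ 𝒰 : Set (Set Y), (∀ U ∈ 𝒰, IsOpen U) → ⋃₀ 𝒰 = Set.univ →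
    ∃ 𝒱 ⊆ 𝒰, 𝒱.Countable ∧ ⋃₀ 𝒱 = Set.univ

/-- ε-space: every ω-cover has a countable subset which is still an ω-cover. -/
def IsEpsilonSpace : Prop :=
  ∀ 𝒰 : Set (Set Y), IsOmegaCover Y 𝒰 → ∃ 𝒱 ⊆ 𝒰, 𝒱.Countable ∧ IsOmegaCover Y 𝒱

/-- k-Lindelöf: every k-cover has a countable subset which is still a k-cover. -/
def IsKLindelof : Prop :=
  ∀ 𝒰 : Set (Set Y), IsKCover Y 𝒰 → ∃ 𝒱 ⊆ 𝒰, 𝒱.Countable ∧ IsKCover Y 𝒱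

end Covers

section Games

variable {ι κ : Type*}

/-- The selection principle `S_1(A, B)`. -/
def S1 (A B : Set (Set ι)) : Prop :=
  ∀ a : ℕ → Set ι, (∀ n, a n ∈ A) →
    ∃ x : ℕ → ι, (∀ n, x n ∈ a n) ∧ Set.range x ∈ B

/-- The selection principle `S_fin(A, B)`. -/
def Sfin (A B : Set (Set ι)) : Prop :=
  ∀ a : ℕ → Set ι, (∀ n, a n ∈ A) →
    ∃ F : ℕ → Set ι, (∀ n, F n ⊆ a n ∧ (F n).Finite) ∧ (⋃ n, F n) ∈ B

/-- One has a winning (full-information) strategy in the single-selection game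
`G_1(A, B)`: a function from finite sequences of Two's moves into `A` such that
every legal run produces a set of Two's selections which is not in `B`. -/
def OneWin1 (A B : Set (Set ι)) : Prop :=
  ∃ σ : List ι → Set ι, (∀ h, σ h ∈ A) ∧
    ∀ x : ℕ → ι, (∀ n, x n ∈ σ (List.ofFn fun i : Fin n => x i)) → Set.range x ∉ B

/-- One has a winning predetermined strategy in `G_1(A, B)`. -/
def OnePre1 (A B : Set (Set ι)) : Prop :=
  ∃ σ : ℕ → Set ι, (∀ n, σ n ∈ A) ∧
    ∀ x : ℕ → ι, (∀ n, x n ∈ σ n) → Set.range x ∉ B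

/-- One has a winning constant strategy in `G_1(A, B)`. -/
def OneConst1 (A B : Set (Set ι)) : Prop :=
  ∃ A₀ ∈ A, ∀ x : ℕ → ι, (∀ n, x n ∈ A₀) → Set.range x ∉ B

/-- Two has a winning (full-information) strategy in `G_1(A, B)`. -/
def TwoWin1 (A B : Set (Set ι)) : Prop :=
  ∃ τ : List (Set ι) → ι, ∀ a : ℕ → Set ι, (∀ n, a n ∈ A) →
    (∀ n, τ (List.ofFn fun i : Fin (n + 1) => a i) ∈ a n) ∧
    Set.range (fun n => τ (List.ofFn fun i : Fin (n + 1) => a i)) ∈ B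

/-- Two has a winning Markov strategy in `G_1(A, B)`. -/
def TwoMarkov1 (A B : Set (Set ι)) : Prop :=
  ∃ τ : Set ι → ℕ → ι, ∀ a : ℕ → Set ι, (∀ n, a n ∈ A) →
    (∀ n, τ (a n) n ∈ a n) ∧ Set.range (fun n => τ (a n) n) ∈ B

/-- One has a winning (full-information) strategy in the finite-selection game
`G_fin(A, B)`. -/
def OneWinFin (A B : Set (Set ι)) : Prop :=
  ∃ σ : List (Set ι) → Set ι, (∀ h, σ h ∈ A) ∧
    ∀ F : ℕ → Set ι,
      (∀ n, F n ⊆ σ (List.ofFn fun i : Fin n => F i) ∧ (F n).Finite) →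
      (⋃ n, F n) ∉ B

/-- One has a winning predetermined strategy in `G_fin(A, B)`. -/
def OnePreFin (A B : Set (Set ι)) : Prop :=
  ∃ σ : ℕ → Set ι, (∀ n, σ n ∈ A) ∧
    ∀ F : ℕ → Set ι, (∀ n, F n ⊆ σ n ∧ (F n).Finite) → (⋃ n, F n) ∉ B

/-- One has a winning constant strategy in `G_fin(A, B)`. -/
def OneConstFin (A B : Set (Set ι)) : Prop :=
  ∃ A₀ ∈ A, ∀ F : ℕ → Set ι, (∀ n, F n ⊆ A₀ ∧ (F n).Finite) → (⋃ n, F n) ∉ B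

/-- Two has a winning (full-information) strategy in `G_fin(A, B)`. -/
def TwoWinFin (A B : Set (Set ι)) : Prop :=
  ∃ τ : List (Set ι) → Set ι, ∀ a : ℕ → Set ι, (∀ n, a n ∈ A) →
    (∀ n, τ (List.ofFn fun i : Fin (n + 1) => a i) ⊆ a n ∧
      (τ (List.ofFn fun i : Fin (n + 1) => a i)).Finite) ∧
    (⋃ n, τ (List.ofFn fun i : Fin (n + 1) => a i)) ∈ B

/-- Two has a winning Markov strategy in `G_fin(A, B)`. -/
def TwoMarkovFin (A B : Set (Set ι)) : Prop :=
  ∃ τ : Set ι → ℕ → Set ι, ∀ a : ℕ → Set ι, (∀ n, a n ∈ A) →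
    (∀ n, τ (a n) n ⊆ a n ∧ (τ (a n) n).Finite) ∧ (⋃ n, τ (a n) n) ∈ B

/-- `G_1(A,C) ≤_II G_1(B,D)`. -/
def LeTwo1 (A C : Set (Set ι)) (B D : Set (Set κ)) : Prop :=
  (TwoMarkov1 A C → TwoMarkov1 B D) ∧
  (TwoWin1 A C → TwoWin1 B D) ∧
  (¬ OneWin1 A C → ¬ OneWin1 B D) ∧
  (¬ OnePre1 A C → ¬ OnePre1 B D) ∧
  (¬ OneConst1 A C → ¬ OneConst1 B D)

/-- `G_fin(A,C) ≤_II G_fin(B,D)`. -/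
def LeTwoFin (A C : Set (Set ι)) (B D : Set (Set κ)) : Prop :=
  (TwoMarkovFin A C → TwoMarkovFin B D) ∧
  (TwoWinFin A C → TwoWinFin B D) ∧
  (¬ OneWinFin A C → ¬ OneWinFin B D) ∧
  (¬ OnePreFin A C → ¬ OnePreFin B D) ∧
  (¬ OneConstFin A C → ¬ OneConstFin B D)

/-- `G_1(A,C) ≡ G_1(B,D)`. -/
def Equiv1 (A C : Set (Set ι)) (B D : Set (Set κ)) : Prop :=
  (TwoMarkov1 A C ↔ TwoMarkov1 B D) ∧
  (TwoWin1 A C ↔ TwoWin1 B D) ∧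
  (OneWin1 A C ↔ OneWin1 B D) ∧
  (OnePre1 A C ↔ OnePre1 B D) ∧
  (OneConst1 A C ↔ OneConst1 B D)

/-- `G_fin(A,C) ≡ G_fin(B,D)`. -/
def EquivFin (A C : Set (Set ι)) (B D : Set (Set κ)) : Prop :=
  (TwoMarkovFin A C ↔ TwoMarkovFin B D) ∧
  (TwoWinFin A C ↔ TwoWinFin B D) ∧
  (OneWinFin A C ↔ OneWinFin B D) ∧
  (OnePreFin A C ↔ OnePreFin B D) ∧
  (OneConstFin A C ↔ OneConstFin B D)

end Games

section Hyperspace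

variable (X : Type*) [TopologicalSpace X]

/-- `𝕂(X)`: the nonempty compact subsets of `X`. -/
abbrev KHyper := {K : Set X // IsCompact K ∧ K.Nonempty}

/-- The Vietoris topology on `𝕂(X)`, generated by the sets
`{K : K ⊆ U}` and `{K : K ∩ U ≠ ∅}` for `U` open in `X`. -/
instance (priority := 2000) vietorisTopology : TopologicalSpace (KHyper X) :=
  TopologicalSpace.generateFrom
    ({S | ∃ U : Set X, IsOpen U ∧ S = {K : KHyper X | K.1 ⊆ U}} ∪
     {S | ∃ U : Set X, IsOpen U ∧ S = {K : KHyper X | (K.1 ∩ U).Nonempty}})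

/-- `[U] = {K ∈ 𝕂(X) : K ⊆ U}`. -/
def vLower (U : Set X) : Set (KHyper X) := {K | K.1 ⊆ U}

/-- `P_fin(X)`: the subspace of `𝕂(X)` of nonempty finite subsets of `X`. -/
abbrev PFinH := {K : KHyper X // K.1.Finite}

/-- A family `𝒜` of subsets of `X` viewed as a subspace `𝔸` of `𝕂(X)`. -/
abbrev ASub (𝒜 : Set (Set X)) := {K : KHyper X // K.1 ∈ 𝒜}

end Hyperspace

/-- An ideal of compact proper subsets of a space: closed under finite unions
and under compact subsets. -/
def IsCompactIdealOn {Y : Type*} [TopologicalSpace Y] (ℬ : Set (Set Y)) : Prop :=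
  (∀ B ∈ ℬ, IsCompact B ∧ B ≠ Set.univ) ∧
  (∀ B ∈ ℬ, ∀ C ∈ ℬ, B ∪ C ∈ ℬ) ∧
  (∀ B ∈ ℬ, ∀ C : Set Y, IsCompact C → C ⊆ B → C ∈ ℬ)

/-- `ℬ` witnesses that the ideal `𝒜` of compact subsets of `X` is closed under
`𝒜`-unions: `ℬ` is an ideal of compact subsets of the subspace `𝔸 = 𝒜` of
`𝕂(X)` such that (i) for every `K₀ ∈ 𝒜`, `{K ∈ 𝔸 : K ⊆ K₀} ∈ ℬ`, and
(ii) for every `KK ∈ ℬ`, `⋃ KK ∈ 𝒜`. -/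
def WitnessesAUnions {X : Type*} [TopologicalSpace X] (𝒜 : Set (Set X))
    (ℬ : Set (Set (ASub X 𝒜))) : Prop :=
  IsCompactIdealOn ℬ ∧
  (∀ K₀ ∈ 𝒜, {K : ASub X 𝒜 | K.1.1 ⊆ K₀} ∈ ℬ) ∧
  (∀ KK ∈ ℬ, (⋃ K ∈ KK, (K : ASub X 𝒜).1.1) ∈ 𝒜)

/-- `X^{≤n}`: the disjoint union of `X, X², …, Xⁿ`. -/
abbrev LePow (X : Type*) (n : ℕ) := Σ i : Fin n, (Fin (i.1 + 1) → X)

/-- `X^{<ω}`: the disjoint union of all finite powers `Xⁿ`, `n ≥ 1`. -/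
abbrev FinPows (X : Type*) := Σ n : ℕ, (Fin (n + 1) → X)

/-- `A^{≤n}`: the copy of the disjoint union of `A, A², …, Aⁿ` inside `X^{≤n}`. -/
def lePowSet {X : Type*} (n : ℕ) (A : Set X) : Set (LePow X n) :=
  {p | ∀ j, p.2 j ∈ A}

/-- `A^{<ω}` inside `X^{<ω}`. -/
def finPowsSet {X : Type*} (A : Set X) : Set (FinPows X) :=
  {p | ∀ j, p.2 j ∈ A}

section VietorisNeighborhoods

variable {X : Type*} [TopologicalSpace X]

/-- Every Vietoris-open set around `K` contains a set of the form
`{G : G ⊆ ⋃ x ∈ K, N x, G ∩ N x ≠ ∅ for all x ∈ K}` with `N x` an open neighborhood of `x`. -/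
theorem exists_nhds_of_isOpen_kHyper {O : Set (KHyper X)} (hO : IsOpen O) {K : KHyper X}
    (hK : K ∈ O) :
    ∃ N : X → Set X, (∀ x, IsOpen (N x) ∧ x ∈ N x) ∧
      ∀ G : KHyper X, G.1 ⊆ ⋃ x ∈ K.1, N x → (∀ x ∈ K.1, (G.1 ∩ N x).Nonempty) → G ∈ O := by
  classical
  have restrict : ∀ U : Set X, IsOpen U →
      ∀ x, IsOpen (if x ∈ U then U else univ) ∧ x ∈ (if x ∈ U then U else univ) := by
    intro U hU x
    split_ifs with h
    exacts [⟨hU, h⟩, ⟨isOpen_univ, mem_univ x⟩]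
  induction hO with
  | basic S hS =>
    rcases hS with ⟨U, hU, rfl⟩ | ⟨U, hU, rfl⟩
    · refine ⟨fun x => if x ∈ U then U else univ, restrict U hU, fun G hG _ => ?_⟩
      refine hG.trans (iUnion₂_subset fun x hx => ?_)
      exact (if_pos (hK hx)).subset
    · obtain ⟨x, hxK, hxU⟩ := hK
      refine ⟨fun x => if x ∈ U then U else univ, restrict U hU, fun G _ hG => ?_⟩
      have hGU : (G.1 ∩ U).Nonempty := by simpa only [if_pos hxU] using hG x hxK
      exact hGU
  | univ => exact ⟨fun _ => univ, fun x => ⟨isOpen_univ, mem_univ x⟩, fun _ _ _ => mem_univ _⟩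
  | inter S T _ _ ihS ihT =>
    obtain ⟨N, hN, hNS⟩ := ihS hK.1
    obtain ⟨M, hM, hMT⟩ := ihT hK.2
    refine ⟨fun x => N x ∩ M x,
      fun x => ⟨(hN x).1.inter (hM x).1, (hN x).2, (hM x).2⟩, fun G hG hG' => ⟨?_, ?_⟩⟩
    · exact hNS G (hG.trans (iUnion₂_mono fun x _ => inter_subset_left))
        fun x hx => (hG' x hx).mono (inter_subset_inter_right _ inter_subset_left)
    · exact hMT G (hG.trans (iUnion₂_mono fun x _ => inter_subset_right))
        fun x hx => (hG' x hx).mono (inter_subset_inter_right _ inter_subset_right)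
  | sUnion 𝒮 _ ih =>
    obtain ⟨S, hS, hKS⟩ := hK
    obtain ⟨N, hN, hNS⟩ := ih S hS hKS
    exact ⟨N, hN, fun G hG hG' => ⟨S, hS, hNS G hG hG'⟩⟩

/-- `[U]` computed in `P_fin(X)`. -/
def finLower (X : Type*) [TopologicalSpace X] (U : Set X) : Set (PFinH X) := {K | K.1.1 ⊆ U}

theorem isOpen_finLower {U : Set X} (hU : IsOpen U) : IsOpen (finLower X U) :=
  (TopologicalSpace.isOpen_generateFrom_of_mem (Or.inl ⟨U, hU, rfl⟩) :
    IsOpen (vLower X U)).preimage continuous_subtype_val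

/-- The nonempty finite set `F` as a point of `P_fin(X)`. -/
def pFinMk (F : Set X) (hF : F.Finite) (hne : F.Nonempty) : PFinH X :=
  ⟨⟨F, hF.isCompact, hne⟩, hF⟩

theorem finLower_eq_univ_iff {U : Set X} : finLower X U = univ ↔ U = univ := by
  refine ⟨fun h => eq_univ_of_forall fun x => ?_, fun h => ?_⟩
  · have : pFinMk {x} (finite_singleton x) (singleton_nonempty x) ∈ finLower X U := h ▸ mem_univ _
    exact this rfl
  · subst h
    exact eq_univ_of_forall fun K => subset_univ K.1.1

/-- An open subset of `P_fin(X)` containing all nonempty subsets of a finite set `F` contains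
`[V]` for some open `V ⊇ F`. -/
theorem exists_finLower_subset {W : Set (PFinH X)} (hW : IsOpen W) {F : Set X} (hF : F.Finite)
    (hFW : finLower X F ⊆ W) : ∃ V, IsOpen V ∧ F ⊆ V ∧ finLower X V ⊆ W := by
  obtain ⟨O, hO, rfl⟩ := isOpen_induced_iff.mp hW
  have key : ∀ K : Set X, ∃ N : X → Set X, (∀ x, IsOpen (N x) ∧ x ∈ N x) ∧
      (K ⊆ F → K.Nonempty → ∀ G : KHyper X, G.1 ⊆ ⋃ x ∈ K, N x →
        (∀ x ∈ K, (G.1 ∩ N x).Nonempty) → G ∈ O) := by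
    intro K
    by_cases hK : K ⊆ F ∧ K.Nonempty
    · obtain ⟨N, hN, h⟩ := exists_nhds_of_isOpen_kHyper hO
        (K := (pFinMk K (hF.subset hK.1) hK.2).1) (hFW hK.1)
      exact ⟨N, hN, fun _ _ => h⟩
    · exact ⟨fun _ => univ, fun x => ⟨isOpen_univ, mem_univ x⟩, fun h h' => (hK ⟨h, h'⟩).elim⟩
  choose N hN hNO using key
  set M : X → Set X := fun x => ⋂ K ∈ 𝒫 F, N K x
  have hMN : ∀ K ⊆ F, ∀ x, M x ⊆ N K x := fun K hK x => biInter_subset_of_mem hK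
  refine ⟨⋃ x ∈ F, M x, isOpen_biUnion fun x _ => hF.finite_subsets.isOpen_biInter
    fun K _ => (hN K x).1, fun x hx => mem_biUnion hx (mem_iInter₂.2 fun K _ => (hN K x).2), ?_⟩
  intro G hG
  have hKF : {x ∈ F | (G.1.1 ∩ M x).Nonempty} ⊆ F := sep_subset _ _
  have hGM : G.1.1 ⊆ ⋃ x ∈ {x ∈ F | (G.1.1 ∩ M x).Nonempty}, M x := by
    intro g hg
    obtain ⟨x, hx, hgx⟩ := mem_iUnion₂.1 (hG hg)
    exact mem_biUnion ⟨hx, g, hg, hgx⟩ hgx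
  refine hNO _ hKF ?_ G.1 (hGM.trans (iUnion₂_mono fun x _ => hMN _ hKF x))
    fun x hx => hx.2.mono (inter_subset_inter_right _ (hMN _ hKF x))
  obtain ⟨g, hg⟩ := G.1.2.2
  obtain ⟨x, hx, -⟩ := mem_iUnion₂.1 (hGM hg)
  exact ⟨x, hx⟩

end VietorisNeighborhoods

section Selection

theorem isOmegaCover_of_finite {Y : Type*} [TopologicalSpace Y] {𝒰 : Set (Set Y)}
    (ho : ∀ U ∈ 𝒰, IsOpen U) (hu : univ ∉ 𝒰) (hF : ∀ F : Set Y, F.Finite → ∃ U ∈ 𝒰, F ⊆ U) :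
    IsOmegaCover Y 𝒰 := by
  refine ⟨⟨ho, eq_univ_of_forall fun y => ?_, hu⟩, hF⟩
  obtain ⟨U, hU, hyU⟩ := hF {y} (finite_singleton y)
  exact ⟨U, hU, hyU rfl⟩

/-- `S_1(Ω,O)` implies the Rothberger property. -/
theorem S1.openCovers_of_omegaCovers {Y : Type*} [TopologicalSpace Y] [Nonempty Y]
    (h : S1 (omegaCovers Y) (openCovers Y)) : S1 (openCovers Y) (openCovers Y) := by
  intro a ha
  have hcov : ∀ n y, ∃ U ∈ a n, y ∈ U := fun n y => by
    have : y ∈ ⋃₀ a n := (ha n).2.1 ▸ mem_univ y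
    exact this
  have finish : ∀ x : ℕ → Set Y, (∀ n, x n ∈ a n) → (∀ y, ∃ n, y ∈ x n) →
      ∃ x : ℕ → Set Y, (∀ n, x n ∈ a n) ∧ range x ∈ openCovers Y := by
    refine fun x hx hy => ⟨x, hx, ?_, eq_univ_of_forall fun y => ?_, ?_⟩
    · rintro _ ⟨n, rfl⟩
      exact (ha n).1 _ (hx n)
    · obtain ⟨n, hn⟩ := hy y
      exact ⟨_, ⟨n, rfl⟩, hn⟩
    · rintro ⟨n, hn⟩
      exact (ha n).2.2 (hn ▸ hx n)
  choose c hca hc using hcov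
  let y₀ : Y := Classical.arbitrary Y
  let b : ℕ → Set (Set Y) := fun n =>
    {V | ∃ u : ℕ → Set Y, (∀ i, u i ∈ a (Nat.pair n i)) ∧ V = ⋃ i, u i}
  by_cases hb : ∃ n, univ ∈ b n
  · obtain ⟨n, u, hu, huniv⟩ := hb
    refine finish (fun m => if (Nat.unpair m).1 = n then u (Nat.unpair m).2 else c m y₀) ?_ ?_
    · intro m
      split_ifs with hm
      · subst hm
        simpa using hu (Nat.unpair m).2
      · exact hca m y₀
    · intro y
      obtain ⟨i, hi⟩ := mem_iUnion.1 (huniv ▸ mem_univ y)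
      exact ⟨Nat.pair n i, by simpa using hi⟩
  · push Not at hb
    have hω : ∀ n, b n ∈ omegaCovers Y := by
      refine fun n => isOmegaCover_of_finite ?_ (hb n) ?_
      · rintro _ ⟨u, hu, rfl⟩
        exact isOpen_iUnion fun i => (ha _).1 _ (hu i)
      · intro F hF
        rcases F.eq_empty_or_nonempty with rfl | hne
        · exact ⟨_, ⟨fun i => c _ y₀, fun i => hca _ _, rfl⟩, empty_subset _⟩
        · obtain ⟨f, rfl⟩ := hF.countable.exists_eq_range hne
          refine ⟨_, ⟨fun i => c _ (f i), fun i => hca _ _, rfl⟩, ?_⟩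
          rintro _ ⟨i, rfl⟩
          exact mem_iUnion.2 ⟨i, hc _ _⟩
    obtain ⟨V, hV, -, hVcov, -⟩ := h b hω
    choose u hu huV using hV
    refine finish (fun m => u (Nat.unpair m).1 (Nat.unpair m).2) (fun m => ?_) fun y => ?_
    · simpa using hu (Nat.unpair m).1 (Nat.unpair m).2
    · obtain ⟨_, ⟨n, rfl⟩, hn⟩ := (hVcov ▸ mem_univ y : y ∈ ⋃₀ range V)
      obtain ⟨i, hi⟩ := mem_iUnion.1 (huV n ▸ hn)
      exact ⟨Nat.pair n i, by simpa using hi⟩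

theorem S1.mono {ι : Type*} {A A' B B' : Set (Set ι)} (hA : A' ⊆ A) (hB : B ⊆ B')
    (h : S1 A B) : S1 A' B' := fun a ha =>
  let ⟨x, hx, hxB⟩ := h a fun n => hA (ha n)
  ⟨x, hx, hB hxB⟩

theorem omegaCovers_subset_openCovers (Y : Type*) [TopologicalSpace Y] :
    omegaCovers Y ⊆ openCovers Y := fun _ h => h.1

variable {X : Type*} [TopologicalSpace X]

theorem IsOmegaCover.finLower {𝒰 : Set (Set X)} (h : IsOmegaCover X 𝒰) :
    IsOmegaCover (PFinH X) (finLower X '' 𝒰) := by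
  refine isOmegaCover_of_finite ?_ ?_ fun F hF => ?_
  · rintro _ ⟨U, hU, rfl⟩
    exact isOpen_finLower (h.1.1 U hU)
  · rintro ⟨U, hU, hUu⟩
    exact h.1.2.2 (finLower_eq_univ_iff.1 hUu ▸ hU)
  · obtain ⟨U, hU, hFU⟩ := h.2 (⋃ K ∈ F, K.1.1) (hF.biUnion fun K _ => K.2)
    exact ⟨_, ⟨U, hU, rfl⟩, fun K hK => (subset_biUnion_of_mem (u := fun K : PFinH X => K.1.1)
      hK).trans hFU⟩

theorem S1.omegaCovers_of_pFinH
    (h : S1 (omegaCovers (PFinH X)) (openCovers (PFinH X))) :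
    S1 (omegaCovers X) (omegaCovers X) := by
  intro a ha
  obtain ⟨W, hW, -, hcov, -⟩ := h _ fun n => (ha n).finLower
  choose U hU hUW using hW
  refine ⟨U, hU, isOmegaCover_of_finite ?_ ?_ fun F hF => ?_⟩
  · rintro _ ⟨n, rfl⟩
    exact (ha n).1.1 _ (hU n)
  · rintro ⟨n, hn⟩
    exact (ha n).1.2.2 (hn ▸ hU n)
  · rcases F.eq_empty_or_nonempty with rfl | hne
    · exact ⟨U 0, ⟨0, rfl⟩, empty_subset _⟩
    · obtain ⟨_, ⟨n, rfl⟩, hn⟩ := (hcov ▸ mem_univ _ : pFinMk F hF hne ∈ ⋃₀ range W)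
      rw [← hUW n] at hn
      exact ⟨U n, ⟨n, rfl⟩, hn⟩

theorem S1.pFinH_of_omegaCovers (h : S1 (omegaCovers X) (omegaCovers X)) :
    S1 (omegaCovers (PFinH X)) (omegaCovers (PFinH X)) := by
  intro a ha
  have hω : ∀ n, {V | IsOpen V ∧ ∃ W ∈ a n, finLower X V ⊆ W} ∈ omegaCovers X := by
    refine fun n => isOmegaCover_of_finite (fun V hV => hV.1) ?_ fun F hF => ?_
    · rintro ⟨-, W, hW, hsub⟩
      rw [finLower_eq_univ_iff.2 rfl, univ_subset_iff] at hsub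
      exact (ha n).1.2.2 (hsub ▸ hW)
    · have hfin : (finLower X F).Finite :=
        Finite.of_finite_image (f := fun K : PFinH X => K.1.1)
          (hF.finite_subsets.subset (image_subset_iff.2 fun K hK => hK))
          ((Subtype.val_injective.comp Subtype.val_injective).injOn)
      obtain ⟨W, hW, hFW⟩ := (ha n).2 _ hfin
      obtain ⟨V, hV, hFV, hVW⟩ := exists_finLower_subset ((ha n).1.1 W hW) hF hFW
      exact ⟨V, ⟨hV, W, hW, hVW⟩, hFV⟩
  obtain ⟨V, hV, hVω⟩ := h _ hω
  choose W hW hVW using fun n => (hV n).2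
  refine ⟨W, hW, isOmegaCover_of_finite ?_ ?_ fun F hF => ?_⟩
  · rintro _ ⟨n, rfl⟩
    exact (ha n).1.1 _ (hW n)
  · rintro ⟨n, hn⟩
    exact (ha n).1.2.2 (hn ▸ hW n)
  · obtain ⟨_, ⟨_, ⟨n, rfl⟩, rfl⟩, hFn⟩ := hVω.finLower.2 F hF
    exact ⟨W n, ⟨n, rfl⟩, hFn.trans (hVW n)⟩

end Selection

/-- For any infinite Hausdorff space `X`, the following are equivalent:
(a) `X ⊨ S_1(Ω,Ω)`; (b) `P_fin(X) ⊨ S_1(Ω,Ω)`; (c) `P_fin(X)` is Rothberger. -/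
theorem statement12 {X : Type*} [TopologicalSpace X] [T2Space X] [Infinite X] :
    (S1 (omegaCovers X) (omegaCovers X) ↔
      S1 (omegaCovers (PFinH X)) (omegaCovers (PFinH X))) ∧
    (S1 (omegaCovers (PFinH X)) (omegaCovers (PFinH X)) ↔
      S1 (openCovers (PFinH X)) (openCovers (PFinH X))) := by
  have : Nonempty (PFinH X) :=
    ⟨pFinMk {Classical.arbitrary X} (finite_singleton _) (singleton_nonempty _)⟩
  have hΩO := omegaCovers_subset_openCovers (PFinH X)
  exact ⟨⟨S1.pFinH_of_omegaCovers, fun h => (h.mono subset_rfl hΩO).omegaCovers_of_pFinH⟩,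
    fun h => (h.mono subset_rfl hΩO).openCovers_of_omegaCovers,
    fun h => (h.mono hΩO subset_rfl).omegaCovers_of_pFinH.pFinH_of_omegaCovers⟩
end

section
/- For any infinite Hausdorff space X, the following are equivalent: (a) X satisfies S_fin(Ω,Ω); (b) P_fin(X) satisfies S_fin(Ω,Ω); (c) P_fin(X) is Menger. -/
open Set

/-- Every Vietoris-open set around `K` contains a set of the form
`{L : L ⊆ ⋃ x ∈ K, V x and L meets V x for all x ∈ K}`. -/
theorem exists_nhd_assignment_of_isOpen {X : Type*} [TopologicalSpace X] {W : Set (KHyper X)}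
    (hW : IsOpen W) {K : KHyper X} (hK : K ∈ W) :
    ∃ V : X → Set X, (∀ x, IsOpen (V x) ∧ x ∈ V x) ∧
      ∀ L : KHyper X, L.1 ⊆ ⋃ x ∈ K.1, V x → (∀ x ∈ K.1, (L.1 ∩ V x).Nonempty) → L ∈ W := by
  have isOpen_imp (U : Set X) (hU : IsOpen U) (x : X) : IsOpen {y | x ∈ U → y ∈ U} := by
    by_cases hx : x ∈ U <;> simp [hx, hU]
  induction hW with
  | basic s hs =>
    rcases hs with ⟨U, hU, rfl⟩ | ⟨U, hU, rfl⟩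
    · refine ⟨fun x => {y | x ∈ U → y ∈ U}, fun x => ⟨isOpen_imp U hU x, id⟩, ?_⟩
      intro L hL _ y hy
      obtain ⟨x, hx, hxy⟩ := mem_iUnion₂.1 (hL hy)
      exact hxy (hK hx)
    · refine ⟨fun x => {y | x ∈ U → y ∈ U}, fun x => ⟨isOpen_imp U hU x, id⟩, ?_⟩
      intro L _ hL
      obtain ⟨x, hx, hxU⟩ := hK
      obtain ⟨y, hy, hxy⟩ := hL x hx
      exact ⟨y, hy, hxy hxU⟩
  | univ => exact ⟨fun _ => univ, fun x => ⟨isOpen_univ, mem_univ x⟩, fun _ _ _ => mem_univ _⟩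
  | inter s t _ _ ihs iht =>
    obtain ⟨V, hV, hVs⟩ := ihs hK.1
    obtain ⟨V', hV', hVt⟩ := iht hK.2
    refine ⟨fun x => V x ∩ V' x, fun x => ⟨(hV x).1.inter (hV' x).1, (hV x).2, (hV' x).2⟩, ?_⟩
    intro L hsub hmeet
    exact ⟨hVs L (hsub.trans (iUnion₂_mono fun _ _ => inter_subset_left))
        fun x hx => (hmeet x hx).mono (inter_subset_inter_right _ inter_subset_left),
      hVt L (hsub.trans (iUnion₂_mono fun _ _ => inter_subset_right))
        fun x hx => (hmeet x hx).mono (inter_subset_inter_right _ inter_subset_right)⟩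
  | sUnion S _ ih =>
    obtain ⟨s, hs, hKs⟩ := hK
    obtain ⟨V, hV, hVs⟩ := ih s hs hKs
    exact ⟨V, hV, fun L hsub hmeet => ⟨s, hs, hVs L hsub hmeet⟩⟩

/-- An open subset of `P_fin(X)` containing all nonempty subsets of a finite set `G` contains all
nonempty finite subsets of some open neighbourhood of `G`. -/
theorem exists_isOpen_forall_subset_mem {X : Type*} [TopologicalSpace X] {W : Set (PFinH X)}
    (hW : IsOpen W) {G : Set X} (hG : G.Finite) (hGW : ∀ K : PFinH X, K.1.1 ⊆ G → K ∈ W) :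
    ∃ U : Set X, IsOpen U ∧ G ⊆ U ∧ ∀ K : PFinH X, K.1.1 ⊆ U → K ∈ W := by
  obtain ⟨W, hWo, rfl⟩ := isOpen_induced_iff.1 hW
  have nhds_of_subset (S : {S : Set X // S ⊆ G ∧ S.Nonempty}) :
      ∃ V : X → Set X, (∀ x, IsOpen (V x) ∧ x ∈ V x) ∧
        ∀ L : KHyper X, L.1 ⊆ ⋃ x ∈ S.1, V x → (∀ x ∈ S.1, (L.1 ∩ V x).Nonempty) → L ∈ W := by
    have hS : S.1.Finite := hG.subset S.2.1
    exact exists_nhd_assignment_of_isOpen hWo (K := ⟨S.1, hS.isCompact, S.2.2⟩)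
      (hGW ⟨⟨S.1, hS.isCompact, S.2.2⟩, hS⟩ S.2.1)
  choose V hV hVW using nhds_of_subset
  have : Finite {S : Set X // S ⊆ G ∧ S.Nonempty} :=
    (hG.finite_subsets.subset fun _ hS => hS.1 : {S : Set X | S ⊆ G ∧ S.Nonempty}.Finite)
  refine ⟨⋃ x ∈ G, ⋂ S, V S x,
    isOpen_biUnion fun x _ => isOpen_iInter_of_finite fun S => (hV S x).1,
    fun x hx => mem_iUnion₂.2 ⟨x, hx, mem_iInter.2 fun S => (hV S x).2⟩, fun K hK => ?_⟩
  have cover (y : X) (hy : y ∈ K.1.1) : ∃ x ∈ G, y ∈ ⋂ S, V S x := by simpa using hK hy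
  let S : {S : Set X // S ⊆ G ∧ S.Nonempty} :=
    ⟨{x | x ∈ G ∧ (K.1.1 ∩ ⋂ S, V S x).Nonempty}, fun x hx => hx.1, by
      obtain ⟨y, hy⟩ := K.1.2.2
      obtain ⟨x, hx, hyx⟩ := cover y hy
      exact ⟨x, hx, y, hy, hyx⟩⟩
  refine hVW S K.1 (fun y hy => ?_) fun x hx =>
    hx.2.mono (inter_subset_inter_right _ (iInter_subset _ S))
  obtain ⟨x, hx, hyx⟩ := cover y hy
  exact mem_iUnion₂.2 ⟨x, ⟨hx, y, hy, hyx⟩, mem_iInter.1 hyx S⟩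

theorem isOpen_setOf_subset_pFinH {X : Type*} [TopologicalSpace X] {U : Set X} (hU : IsOpen U) :
    IsOpen {K : PFinH X | K.1.1 ⊆ U} := by
  have : IsOpen {K : KHyper X | K.1 ⊆ U} :=
    TopologicalSpace.isOpen_generateFrom_of_mem (Or.inl ⟨U, hU, rfl⟩)
  exact this.preimage continuous_subtype_val

/-- A family of open sets capturing all finite sets and omitting the whole space is an ω-cover. -/
theorem isOmegaCover_of_forall_finite {Y : Type*} [TopologicalSpace Y] {𝒰 : Set (Set Y)}
    (hopen : ∀ U ∈ 𝒰, IsOpen U) (huniv : univ ∉ 𝒰)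
    (hfin : ∀ F : Set Y, F.Finite → ∃ U ∈ 𝒰, F ⊆ U) : IsOmegaCover Y 𝒰 := by
  refine ⟨⟨hopen, eq_univ_of_forall fun y => ?_, huniv⟩, hfin⟩
  obtain ⟨U, hU, hy⟩ := hfin {y} (finite_singleton y)
  exact ⟨U, hU, hy rfl⟩

/-- If every member of a finite family `F` is related to some member of `a`, then finitely many
members of `a` suffice. -/
theorem exists_finite_selection_above {Y Z : Type*} {R : Set Z → Set Y → Prop}
    {a : Set (Set Y)} {F : Set (Set Z)} (hF : F.Finite) (h : ∀ V ∈ F, ∃ U ∈ a, R V U) :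
    ∃ E : Set (Set Y), (E ⊆ a ∧ E.Finite) ∧ ∀ V ∈ F, ∃ U ∈ E, R V U := by
  choose! f hfa hfR using h
  exact ⟨f '' F, ⟨image_subset_iff.2 hfa, hF.image f⟩,
    fun V hV => ⟨f V, mem_image_of_mem f hV, hfR V hV⟩⟩

/-- `S_fin(Ω,Ω)` passes from `X` to `P_fin(X)`. -/
theorem sfin_omega_pFinH {X : Type*} [TopologicalSpace X]
    (h : Sfin (omegaCovers X) (omegaCovers X)) :
    Sfin (omegaCovers (PFinH X)) (omegaCovers (PFinH X)) := by
  intro a ha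
  let b (n : ℕ) : Set (Set X) := {U | IsOpen U ∧ ∃ W ∈ a n, ∀ K : PFinH X, K.1.1 ⊆ U → K ∈ W}
  have hb (n : ℕ) : b n ∈ omegaCovers X := by
    refine isOmegaCover_of_forall_finite (fun U hU => hU.1) ?_ fun G hG => ?_
    · rintro ⟨-, W, hW, hsub⟩
      exact (ha n).1.2.2 (eq_univ_of_forall (fun K => hsub K (subset_univ _)) ▸ hW)
    · have hsubsets : {K : PFinH X | K.1.1 ⊆ G}.Finite :=
        hG.finite_subsets.preimage
          (Subtype.val_injective.comp Subtype.val_injective).injOn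
      obtain ⟨W, hW, hGW⟩ := (ha n).2 _ hsubsets
      obtain ⟨U, hU, hGU, hUW⟩ :=
        exists_isOpen_forall_subset_mem ((ha n).1.1 W hW) hG fun K hK => hGW hK
      exact ⟨U, ⟨hU, W, hW, hUW⟩, hGU⟩
  obtain ⟨F, hF, hFΩ⟩ := h b hb
  choose E hE hEF using fun n => exists_finite_selection_above
    (R := fun U W => ∀ K : PFinH X, K.1.1 ⊆ U → K ∈ W) (hF n).2 fun U hU => ((hF n).1 hU).2
  refine ⟨E, hE, isOmegaCover_of_forall_finite (fun W hW => ?_) (fun hW => ?_) fun 𝒦 h𝒦 => ?_⟩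
  · obtain ⟨n, hn⟩ := mem_iUnion.1 hW
    exact (ha n).1.1 W ((hE n).1 hn)
  · obtain ⟨n, hn⟩ := mem_iUnion.1 hW
    exact (ha n).1.2.2 ((hE n).1 hn)
  · obtain ⟨U, hU, hsub⟩ := hFΩ.2 (⋃ K ∈ 𝒦, K.1.1) (h𝒦.biUnion fun K _ => K.2)
    obtain ⟨n, hn⟩ := mem_iUnion.1 hU
    obtain ⟨W, hW, hUW⟩ := hEF n U hn
    exact ⟨W, mem_iUnion.2 ⟨n, hW⟩,
      fun K hK => hUW K ((subset_biUnion_of_mem (u := fun K : PFinH X => K.1.1) hK).trans hsub)⟩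

/-- `S_fin(Ω,Ω)` implies the Menger property. -/
theorem menger_of_sfin_omega {Y : Type*} [TopologicalSpace Y]
    (h : Sfin (omegaCovers Y) (omegaCovers Y)) : Sfin (openCovers Y) (openCovers Y) := by
  intro a ha
  suffices ∃ F : ℕ → Set (Set Y), (∀ n, F n ⊆ a n ∧ (F n).Finite) ∧ ⋃₀ (⋃ n, F n) = univ by
    obtain ⟨F, hF, hcov⟩ := this
    refine ⟨F, hF, fun U hU => ?_, hcov, fun hU => ?_⟩
    · obtain ⟨n, hn⟩ := mem_iUnion.1 hU
      exact (ha n).1 U ((hF n).1 hn)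
    · obtain ⟨n, hn⟩ := mem_iUnion.1 hU
      exact (ha n).2.2 ((hF n).1 hn)
  by_cases hsub : ∃ n, ∃ E ⊆ a n, E.Finite ∧ ⋃₀ E = univ
  · obtain ⟨n, E, hEa, hE, hcov⟩ := hsub
    refine ⟨fun m => {U | m = n ∧ U ∈ E}, fun m => ⟨?_, hE.subset fun U hU => hU.2⟩, ?_⟩
    · rintro U ⟨rfl, hU⟩
      exact hEa hU
    · exact univ_subset_iff.1 (hcov ▸ sUnion_subset_sUnion
        fun U hU => mem_iUnion.2 ⟨n, rfl, hU⟩)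
  push Not at hsub
  let b (n : ℕ) : Set (Set Y) := {V | ∃ E ⊆ a n, E.Finite ∧ ⋃₀ E = V}
  have hb (n : ℕ) : b n ∈ omegaCovers Y := by
    refine isOmegaCover_of_forall_finite ?_ ?_ fun G hG => ?_
    · rintro _ ⟨E, hE, -, rfl⟩
      exact isOpen_sUnion fun U hU => (ha n).1 U (hE hU)
    · rintro ⟨E, hEa, hE, hcov⟩
      exact hsub n E hEa hE hcov
    · have hmem (y : Y) : ∃ U ∈ a n, y ∈ U := eq_univ_iff_forall.1 (ha n).2.1 y
      choose f hfa hf using hmem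
      exact ⟨_, ⟨f '' G, image_subset_iff.2 fun y _ => hfa y, hG.image f, rfl⟩,
        fun y hy => ⟨f y, mem_image_of_mem f hy, hf y⟩⟩
  obtain ⟨F, hF, hFΩ⟩ := h b hb
  choose! E hEa hE hEV using fun n V (hV : V ∈ F n) => (hF n).1 hV
  refine ⟨fun n => ⋃ V ∈ F n, E n V, fun n => ⟨iUnion₂_subset (hEa n), (hF n).2.biUnion (hE n)⟩,
    eq_univ_of_forall fun y => ?_⟩
  obtain ⟨V, hV, hy⟩ : y ∈ ⋃₀ ⋃ n, F n := hFΩ.1.2.1 ▸ mem_univ y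
  obtain ⟨n, hn⟩ := mem_iUnion.1 hV
  obtain ⟨U, hU, hyU⟩ : y ∈ ⋃₀ E n V := (hEV n V hn).symm ▸ hy
  exact ⟨U, mem_iUnion.2 ⟨n, mem_iUnion₂.2 ⟨V, hn, hU⟩⟩, hyU⟩

/-- If `P_fin(X)` is Menger, then `X` satisfies `S_fin(Ω,Ω)`. -/
theorem sfin_omega_of_menger_pFinH {X : Type*} [TopologicalSpace X] [Nonempty X]
    (h : Sfin (openCovers (PFinH X)) (openCovers (PFinH X))) :
    Sfin (omegaCovers X) (omegaCovers X) := by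
  intro a ha
  let b (n : ℕ) : Set (Set (PFinH X)) := (fun U => {K : PFinH X | K.1.1 ⊆ U}) '' a n
  have hb (n : ℕ) : b n ∈ openCovers (PFinH X) := by
    refine ⟨?_, eq_univ_of_forall fun K => ?_, ?_⟩
    · rintro _ ⟨U, hU, rfl⟩
      exact isOpen_setOf_subset_pFinH ((ha n).1.1 U hU)
    · obtain ⟨U, hU, hKU⟩ := (ha n).2 K.1.1 K.2
      exact ⟨_, mem_image_of_mem _ hU, hKU⟩
    · rintro ⟨U, hU, hcov⟩
      refine (ha n).1.2.2 (eq_univ_of_forall (fun x => ?_) ▸ hU)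
      have hx : (⟨⟨{x}, isCompact_singleton, singleton_nonempty x⟩, finite_singleton x⟩ : PFinH X)
          ∈ {K : PFinH X | K.1.1 ⊆ U} := eq_univ_iff_forall.1 hcov _
      exact hx rfl
  obtain ⟨F, hF, hFO⟩ := h b hb
  choose E hE hEF using fun n => exists_finite_selection_above
    (R := fun V U => {K : PFinH X | K.1.1 ⊆ U} = V) (hF n).2 fun V hV => (hF n).1 hV
  refine ⟨E, hE, isOmegaCover_of_forall_finite (fun U hU => ?_) (fun hU => ?_) fun G hG => ?_⟩
  · obtain ⟨n, hn⟩ := mem_iUnion.1 hU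
    exact (ha n).1.1 U ((hE n).1 hn)
  · obtain ⟨n, hn⟩ := mem_iUnion.1 hU
    exact (ha n).1.2.2 ((hE n).1 hn)
  · obtain ⟨x⟩ := ‹Nonempty X›
    have hG' : (insert x G).Finite := hG.insert x
    let K : PFinH X := ⟨⟨insert x G, hG'.isCompact, insert_nonempty x G⟩, hG'⟩
    obtain ⟨V, hV, hKV⟩ : K ∈ ⋃₀ ⋃ n, F n := hFO.2.1 ▸ mem_univ K
    obtain ⟨n, hn⟩ := mem_iUnion.1 hV
    obtain ⟨U, hU, rfl⟩ := hEF n V hn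
    exact ⟨U, mem_iUnion.2 ⟨n, hU⟩, (subset_insert x G).trans hKV⟩

/-- For any infinite Hausdorff space `X`, the following are equivalent:
(a) `X ⊨ S_fin(Ω,Ω)`; (b) `P_fin(X) ⊨ S_fin(Ω,Ω)`; (c) `P_fin(X)` is Menger. -/
theorem statement13 {X : Type*} [TopologicalSpace X] [T2Space X] [Infinite X] :
    (Sfin (omegaCovers X) (omegaCovers X) ↔
      Sfin (omegaCovers (PFinH X)) (omegaCovers (PFinH X))) ∧
    (Sfin (omegaCovers (PFinH X)) (omegaCovers (PFinH X)) ↔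
      Sfin (openCovers (PFinH X)) (openCovers (PFinH X))) := by
  have menger_imp := sfin_omega_of_menger_pFinH (X := X)
  have omega_imp := menger_of_sfin_omega (Y := PFinH X)
  exact ⟨⟨sfin_omega_pFinH, fun h => menger_imp (omega_imp h)⟩,
    ⟨omega_imp, fun h => sfin_omega_pFinH (menger_imp h)⟩⟩
end

section
/- For any infinite, non-compact Hausdorff space X: G_fin(K_X, K_X) ≡ G_fin(K_{𝕂(X)}, K_{𝕂(X)}) ≡ G_fin(O_{𝕂(X)}, O_{𝕂(X)}). -/
open Set

section Translation

variable {ι κ : Type*}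

/-- Two's selections `F` in a translated move, pulled back along `S b`. -/
def pullSelection (S : Set κ → ι → Set κ) (b : Set κ) (F : Set ι) : Set κ := ⋃ u ∈ F, S b u

/-- The history that One's strategy `σ` sees when Two's selections are pulled back along `S`. -/
def pullHistory (S : Set κ → ι → Set κ) (σ : List (Set κ) → Set κ) (h : List (Set ι)) :
    List (Set κ) :=
  h.foldl (fun g F => g ++ [pullSelection S (σ g) F]) []

theorem pullHistory_ofFn (S : Set κ → ι → Set κ) (σ : List (Set κ) → Set κ) (F : ℕ → Set ι)
    (n : ℕ) :
    pullHistory S σ (List.ofFn fun i : Fin n => F i) =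
      List.ofFn fun i : Fin n =>
        pullSelection S (σ (pullHistory S σ (List.ofFn fun j : Fin i => F j))) (F i) := by
  induction n with
  | zero => simp [pullHistory]
  | succ n ih =>
    rw [List.ofFn_succ', List.ofFn_succ', List.concat_eq_append, List.concat_eq_append]
    simp only [Fin.val_castSucc, Fin.val_last]
    rw [← ih]
    simp [pullHistory]

/-- A translation of One's moves from the game on `κ` to the game on `ι`, with finite pullbacks of
Two's selections that preserve winning, transfers strategies. -/
theorem leTwoFin_of_translation {A C : Set (Set ι)} {B D : Set (Set κ)}
    (T : Set κ → Set ι) (S : Set κ → ι → Set κ)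
    (hT : ∀ b ∈ B, T b ∈ A)
    (hS : ∀ b ∈ B, ∀ u ∈ T b, S b u ⊆ b ∧ (S b u).Finite)
    (hD : ∀ (b : ℕ → Set κ) (F : ℕ → Set ι), (∀ n, b n ∈ B) → (∀ n, F n ⊆ T (b n)) →
      (⋃ n, F n) ∈ C → (⋃ n, pullSelection S (b n) (F n)) ∈ D) :
    LeTwoFin A C B D := by
  have legal : ∀ b ∈ B, ∀ F ⊆ T b, F.Finite →
      pullSelection S b F ⊆ b ∧ (pullSelection S b F).Finite := fun b hb F hF hfin =>
    ⟨iUnion₂_subset fun u hu => (hS b hb u (hF hu)).1,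
      hfin.biUnion fun u hu => (hS b hb u (hF hu)).2⟩
  refine ⟨?_, ?_, ?_, ?_, ?_⟩
  · rintro ⟨τ, hτ⟩
    refine ⟨fun b n => pullSelection S b (τ (T b) n), fun b hb => ?_⟩
    obtain ⟨h₁, h₂⟩ := hτ (fun n => T (b n)) fun n => hT _ (hb n)
    exact ⟨fun n => legal _ (hb n) _ (h₁ n).1 (h₁ n).2, hD b _ hb (fun n => (h₁ n).1) h₂⟩
  · rintro ⟨τ, hτ⟩
    refine ⟨fun l => pullSelection S (l.getLastD ∅) (τ (l.map T)), fun b hb => ?_⟩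
    obtain ⟨h₁, h₂⟩ := hτ (fun n => T (b n)) fun n => hT _ (hb n)
    have key : ∀ n, (List.ofFn fun i : Fin (n + 1) => b i).getLastD ∅ = b n := fun n => by
      rw [List.ofFn_succ', List.concat_eq_append]
      simp
    simp only [List.map_ofFn, key]
    exact ⟨fun n => legal _ (hb n) _ (h₁ n).1 (h₁ n).2, hD b _ hb (fun n => (h₁ n).1) h₂⟩
  · refine mt ?_
    rintro ⟨σ, hσ, hwin⟩
    refine ⟨fun h => T (σ (pullHistory S σ h)), fun h => hT _ (hσ _), fun F hF hC => ?_⟩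
    refine hwin (fun n => pullSelection S
      (σ (pullHistory S σ (List.ofFn fun i : Fin n => F i))) (F n)) (fun n => ?_)
      (hD _ F (fun n => hσ _) (fun n => (hF n).1) hC)
    rw [← pullHistory_ofFn]
    exact legal _ (hσ _) _ (hF n).1 (hF n).2
  · refine mt ?_
    rintro ⟨σ, hσ, hwin⟩
    exact ⟨fun n => T (σ n), fun n => hT _ (hσ n), fun F hF hC =>
      hwin _ (fun n => legal _ (hσ n) _ (hF n).1 (hF n).2) (hD σ F hσ (fun n => (hF n).1) hC)⟩
  · refine mt ?_
    rintro ⟨b, hb, hwin⟩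
    exact ⟨T b, hT _ hb, fun F hF hC => hwin _ (fun n => legal _ hb _ (hF n).1 (hF n).2)
      (hD (fun _ => b) F (fun _ => hb) (fun n => (hF n).1) hC)⟩

theorem EquivFin.of_leTwoFin {A C : Set (Set ι)} {B D : Set (Set κ)}
    (h : LeTwoFin A C B D) (h' : LeTwoFin B D A C) : EquivFin A C B D :=
  ⟨⟨h.1, h'.1⟩, ⟨h.2.1, h'.2.1⟩, not_iff_not.1 ⟨h.2.2.1, h'.2.2.1⟩,
    not_iff_not.1 ⟨h.2.2.2.1, h'.2.2.2.1⟩, not_iff_not.1 ⟨h.2.2.2.2, h'.2.2.2.2⟩⟩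

theorem EquivFin.symm {A C : Set (Set ι)} {B D : Set (Set κ)} (h : EquivFin A C B D) :
    EquivFin B D A C :=
  ⟨h.1.symm, h.2.1.symm, h.2.2.1.symm, h.2.2.2.1.symm, h.2.2.2.2.symm⟩

theorem EquivFin.trans {μ : Type*} {A C : Set (Set ι)} {B D : Set (Set κ)} {E G : Set (Set μ)}
    (h : EquivFin A C B D) (h' : EquivFin B D E G) : EquivFin A C E G :=
  ⟨h.1.trans h'.1, h.2.1.trans h'.2.1, h.2.2.1.trans h'.2.2.1,
    h.2.2.2.1.trans h'.2.2.2.1, h.2.2.2.2.trans h'.2.2.2.2⟩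

end Translation

theorem IsCompact.elim_finite_subcover_sUnion {Y : Type*} [TopologicalSpace Y] {K : Set Y}
    (hK : IsCompact K) {𝒰 : Set (Set Y)} (ho : ∀ U ∈ 𝒰, IsOpen U) (hc : K ⊆ ⋃₀ 𝒰) :
    ∃ t ⊆ 𝒰, t.Finite ∧ K ⊆ ⋃₀ t := by
  simp only [sUnion_eq_biUnion] at hc ⊢
  exact hK.elim_finite_subcover_image ho hc

section Vietoris

open Filter Topology

variable {X : Type*} [TopologicalSpace X]

/-- The one-point subset of `X` as an element of `𝕂(X)`. -/
def KHyper.point (x : X) : KHyper X := ⟨{x}, isCompact_singleton, singleton_nonempty x⟩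

theorem point_mem_vLower {x : X} {U : Set X} : KHyper.point x ∈ vLower X U ↔ x ∈ U :=
  singleton_subset_iff

theorem vLower_mono {U V : Set X} (h : U ⊆ V) : vLower X U ⊆ vLower X V :=
  fun _ hK => Subset.trans hK h

theorem vLower_injective : Function.Injective (vLower X) := fun U V h => by
  ext x
  rw [← point_mem_vLower, h, point_mem_vLower]

theorem vLower_univ : vLower X univ = univ := eq_univ_of_forall fun _ => subset_univ _

theorem isOpen_vLower {U : Set X} (hU : IsOpen U) : IsOpen (vLower X U) :=
  TopologicalSpace.isOpen_generateFrom_of_mem <| .inl ⟨U, hU, rfl⟩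

/-- An ultrafilter on `𝕂(X)` containing `[U]` for every open `U ⊇ K` converges to a point of
`[K]`. -/
theorem exists_le_nhds_of_forall_vLower_mem {K : Set X} (hK : IsCompact K)
    (f : Ultrafilter (KHyper X)) (hf : ∀ U, IsOpen U → K ⊆ U → vLower X U ∈ f) :
    ∃ L ∈ vLower X K, (f : Filter (KHyper X)) ≤ 𝓝 L := by
  let N : Set X := ⋃₀ {V | IsOpen V ∧ {s : KHyper X | (s.1 ∩ V).Nonempty} ∉ f}
  have hN : IsOpen N := isOpen_sUnion fun V hV => hV.1
  have miss : ∀ U, IsOpen U → K \ N ⊆ U → vLower X U ∈ f := by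
    intro U hU hKU
    have hcov : K \ U ⊆ ⋃₀ {V | IsOpen V ∧ {s : KHyper X | (s.1 ∩ V).Nonempty} ∉ f} :=
      fun x hx => by_contra fun hxN => hx.2 (hKU ⟨hx.1, hxN⟩)
    obtain ⟨t, htN, ht, hKt⟩ := (hK.diff hU).elim_finite_subcover_sUnion
      (fun V hV => hV.1) hcov
    have h₁ : vLower X (U ∪ ⋃₀ t) ∈ f :=
      hf _ (hU.union (isOpen_sUnion fun V hV => (htN hV).1)) (sdiff_subset_iff.1 hKt)
    have h₂ : (⋂ V ∈ t, {s : KHyper X | (s.1 ∩ V).Nonempty}ᶜ) ∈ (f : Filter (KHyper X)) :=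
      (biInter_mem ht).2 fun V hV => Ultrafilter.compl_mem_iff_notMem.2 (htN hV).2
    filter_upwards [h₁, h₂] with s hs hs' x hx
    refine (hs hx).resolve_right ?_
    rintro ⟨V, hV, hxV⟩
    exact mem_iInter₂.1 hs' V hV ⟨x, hx, hxV⟩
  have hne : (K \ N).Nonempty := by
    by_contra h
    rw [not_nonempty_iff_eq_empty] at h
    obtain ⟨s, hs⟩ := f.nonempty_of_mem (miss ∅ isOpen_empty h.subset)
    exact s.2.2.ne_empty (subset_empty_iff.1 hs)
  refine ⟨⟨K \ N, hK.diff hN, hne⟩, sdiff_subset, ?_⟩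
  rw [TopologicalSpace.nhds_generateFrom]
  refine le_iInf₂ fun S hS => le_principal_iff.2 ?_
  rcases hS with ⟨hmem, ⟨U, hU, rfl⟩ | ⟨U, hU, rfl⟩⟩
  · exact miss U hU hmem
  · obtain ⟨x, hx, hxU⟩ := hmem
    by_contra h
    exact hx.2 ⟨U, ⟨hU, h⟩, hxU⟩

theorem IsCompact.vLower {K : Set X} (hK : IsCompact K) : IsCompact (vLower X K) :=
  isCompact_iff_ultrafilter_le_nhds.2 fun f hf =>
    exists_le_nhds_of_forall_vLower_mem hK f fun _ _ hKU =>
      mem_of_superset (le_principal_iff.1 hf) (vLower_mono hKU)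

/-- Every open neighbourhood of `[K]` contains `[U]` for some open `U ⊇ K`. -/
theorem IsCompact.exists_vLower_subset {K : Set X} (hK : IsCompact K) {W : Set (KHyper X)}
    (hW : IsOpen W) (hKW : _root_.vLower X K ⊆ W) :
    ∃ U, IsOpen U ∧ K ⊆ U ∧ _root_.vLower X U ⊆ W := by
  have h : W ∈ (𝓝ˢ K).lift' (_root_.vLower X) := by
    refine mem_iff_ultrafilter.2 fun f hf => ?_
    obtain ⟨L, hLK, hL⟩ := exists_le_nhds_of_forall_vLower_mem hK f fun U hU hKU =>
      hf (mem_lift' (hU.mem_nhdsSet.2 hKU))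
    exact hL (hW.mem_nhds (hKW hLK))
  obtain ⟨V, hV, hVW⟩ := (mem_lift'_sets fun _ _ => vLower_mono).1 h
  obtain ⟨U, hU, hKU, hUV⟩ := mem_nhdsSet_iff_exists.1 hV
  exact ⟨U, hU, hKU, (vLower_mono hUV).trans hVW⟩

/-- The union of a compact family of compact sets is compact. -/
theorem IsCompact.biUnion_KHyper {𝒦 : Set (KHyper X)} (h𝒦 : IsCompact 𝒦) :
    IsCompact (⋃ K ∈ 𝒦, K.1) := by
  refine isCompact_of_finite_subcover fun {ι} U hU hcov => ?_
  have hsub : 𝒦 ⊆ ⋃ t : Finset ι, _root_.vLower X (⋃ i ∈ t, U i) := fun K hK => by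
    obtain ⟨t, ht⟩ := K.2.1.elim_finite_subcover U hU ((subset_biUnion_of_mem hK).trans hcov)
    exact mem_iUnion.2 ⟨t, ht⟩
  obtain ⟨t, ht⟩ := h𝒦.elim_directed_cover _
    (fun t => isOpen_vLower (isOpen_biUnion fun i _ => hU i)) hsub
    (directed_of_isDirected_le fun s t hst => vLower_mono (biUnion_subset_biUnion_left hst))
  exact ⟨t, iUnion₂_subset fun K hK => ht hK⟩

end Vietoris

section Covers

/-- The members of `𝒰` whose lower Vietoris set is `W`. -/
def lowerFiber {X : Type*} [TopologicalSpace X] (𝒰 : Set (Set X)) (W : Set (KHyper X)) :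
    Set (Set X) :=
  {U ∈ 𝒰 | vLower X U = W}

/-- The proper open sets `U` such that `[U]` is contained in a member of `𝒲`. -/
def lowerRefinement {X : Type*} [TopologicalSpace X] (𝒲 : Set (Set (KHyper X))) : Set (Set X) :=
  {U | IsOpen U ∧ U ≠ univ ∧ ∃ W ∈ 𝒲, vLower X U ⊆ W}

/-- The proper open sets `U` such that `[U]` is covered by a finite subfamily of `𝒲`. -/
def lowerFiniteRefinement {X : Type*} [TopologicalSpace X] (𝒲 : Set (Set (KHyper X))) :
    Set (Set X) :=
  {U | IsOpen U ∧ U ≠ univ ∧ ∃ ℱ ⊆ 𝒲, ℱ.Finite ∧ vLower X U ⊆ ⋃₀ ℱ}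

variable {X : Type*} [TopologicalSpace X]

theorem isKCover_of_forall_nonempty {Y : Type*} [TopologicalSpace Y] [Nonempty Y]
    {𝒰 : Set (Set Y)} (ho : ∀ U ∈ 𝒰, IsOpen U) (hu : univ ∉ 𝒰)
    (hc : ∀ K : Set Y, IsCompact K → K.Nonempty → ∃ U ∈ 𝒰, K ⊆ U) : IsKCover Y 𝒰 := by
  have hcov : ∀ y, ∃ U ∈ 𝒰, y ∈ U := fun y => by
    simpa using hc {y} isCompact_singleton (singleton_nonempty y)
  refine ⟨⟨ho, eq_univ_of_forall hcov, hu⟩, fun K hK _ => ?_⟩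
  rcases K.eq_empty_or_nonempty with rfl | hne
  · obtain ⟨U, hU, -⟩ := hcov (Classical.arbitrary Y)
    exact ⟨U, hU, empty_subset U⟩
  · exact hc K hK hne

theorem univ_notMem_image_vLower {𝒰 : Set (Set X)} (h : univ ∉ 𝒰) :
    univ ∉ vLower X '' 𝒰 := by
  rintro ⟨U, hU, hU'⟩
  rw [← vLower_univ] at hU'
  exact h (vLower_injective hU' ▸ hU)

theorem IsKCover.image_vLower (hnc : ¬ IsCompact (univ : Set X)) [Nonempty X]
    {𝒰 : Set (Set X)} (h : IsKCover X 𝒰) : IsKCover (KHyper X) (vLower X '' 𝒰) := by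
  have : Nonempty (KHyper X) := ⟨.point (Classical.arbitrary X)⟩
  refine isKCover_of_forall_nonempty (forall_mem_image.2 fun U hU => isOpen_vLower (h.1.1 U hU))
    (univ_notMem_image_vLower h.1.2.2) fun 𝒦 h𝒦 _ => ?_
  have hc := h𝒦.biUnion_KHyper
  obtain ⟨U, hU, hsub⟩ := h.2 _ hc fun h => hnc (h ▸ hc)
  exact ⟨_, mem_image_of_mem _ hU, fun K hK => (subset_biUnion_of_mem hK).trans hsub⟩

/-- If the sets `[U]`, `U ∈ 𝒱`, cover `𝕂(X)`, then `𝒱` is a k-cover. -/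
theorem isKCover_of_vLower_cover [Nonempty X] {𝒱 : Set (Set X)} (ho : ∀ U ∈ 𝒱, IsOpen U)
    (hu : univ ∉ 𝒱) (hc : ∀ K : KHyper X, ∃ U ∈ 𝒱, K ∈ vLower X U) : IsKCover X 𝒱 :=
  isKCover_of_forall_nonempty ho hu fun K hK hne => hc ⟨K, hK, hne⟩

theorem IsKCover.exists_mem_vLower (hnc : ¬ IsCompact (univ : Set X)) {𝒰 : Set (Set X)}
    (h : IsKCover X 𝒰) (K : KHyper X) : ∃ U ∈ 𝒰, K ∈ vLower X U :=
  h.2 K.1 K.2.1 fun hK => hnc (hK ▸ K.2.1)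

/-- The game on `X` is easier for Two than any game on `𝕂(X)` whose target consists of
covers of `𝕂(X)` and whose One moves include the images `{[U] : U ∈ 𝒰}` of k-covers. -/
theorem leTwoFin_kCovers [Nonempty X] {A C : Set (Set (Set (KHyper X)))}
    (hA : ∀ 𝒰, IsKCover X 𝒰 → vLower X '' 𝒰 ∈ A)
    (hC : ∀ 𝒲 ∈ C, ⋃₀ 𝒲 = univ) :
    LeTwoFin A C (kCovers X) (kCovers X) := by
  refine leTwoFin_of_translation (fun 𝒰 => vLower X '' 𝒰) lowerFiber hA
    (fun 𝒰 _ W _ => ⟨sep_subset _ _, Subsingleton.finite fun U hU V hV =>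
      vLower_injective (hU.2.trans hV.2.symm)⟩) fun b F hb hF hcov => ?_
  have hmem : ∀ U ∈ ⋃ n, pullSelection lowerFiber (b n) (F n), ∃ n, U ∈ b n := fun U hU => by
    simp only [pullSelection, mem_iUnion] at hU
    obtain ⟨n, W, -, hUW⟩ := hU
    exact ⟨n, hUW.1⟩
  refine isKCover_of_vLower_cover (fun U hU => ?_) (fun hU => ?_) fun K => ?_
  · obtain ⟨n, hn⟩ := hmem U hU
    exact (hb n).1.1 U hn
  · obtain ⟨n, hn⟩ := hmem _ hU
    exact (hb n).1.2.2 hn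
  · obtain ⟨W, hW, hKW⟩ := mem_sUnion.1 ((hC _ hcov).symm ▸ mem_univ K)
    obtain ⟨n, hn⟩ := mem_iUnion.1 hW
    obtain ⟨U, hU, rfl⟩ := hF n hn
    exact ⟨U, mem_iUnion.2 ⟨n, mem_iUnion₂.2 ⟨_, hn, hU, rfl⟩⟩, hKW⟩

theorem exists_isOpen_ne_univ_vLower_subset [T1Space X] (hnc : ¬ IsCompact (univ : Set X))
    {K : Set X} (hK : IsCompact K) {W : Set (KHyper X)} (hW : IsOpen W) (hKW : vLower X K ⊆ W) :
    ∃ U, IsOpen U ∧ U ≠ univ ∧ K ⊆ U ∧ vLower X U ⊆ W := by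
  obtain ⟨U, hU, hKU, hUW⟩ := hK.exists_vLower_subset hW hKW
  obtain ⟨x, hx⟩ := (ne_univ_iff_exists_notMem K).1 fun h => hnc (h ▸ hK)
  refine ⟨U \ {x}, hU.sdiff isClosed_singleton, (ne_univ_iff_exists_notMem _).2 ⟨x, by simp⟩,
    fun y hy => ⟨hKU hy, fun h => hx (h ▸ hy)⟩, (vLower_mono sdiff_subset).trans hUW⟩

theorem isKCover_lowerRefinement [T1Space X] [Nonempty X] (hnc : ¬ IsCompact (univ : Set X))
    {𝒲 : Set (Set (KHyper X))} (h : IsKCover (KHyper X) 𝒲) :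
    IsKCover X (lowerRefinement 𝒲) := by
  refine isKCover_of_forall_nonempty (fun U hU => hU.1) (fun hU => hU.2.1 rfl) fun K hK _ => ?_
  obtain ⟨W, hW, hKW⟩ := h.2 _ hK.vLower fun h =>
    hnc ((vLower_injective (h.trans vLower_univ.symm)) ▸ hK)
  obtain ⟨U, hU, hne, hKU, hUW⟩ :=
    exists_isOpen_ne_univ_vLower_subset hnc hK (h.1.1 W hW) hKW
  exact ⟨U, ⟨hU, hne, W, hW, hUW⟩, hKU⟩

theorem isKCover_lowerFiniteRefinement [T1Space X] [Nonempty X]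
    (hnc : ¬ IsCompact (univ : Set X)) {𝒲 : Set (Set (KHyper X))}
    (h : IsNontrivialOpenCover (KHyper X) 𝒲) : IsKCover X (lowerFiniteRefinement 𝒲) := by
  refine isKCover_of_forall_nonempty (fun U hU => hU.1) (fun hU => hU.2.1 rfl) fun K hK _ => ?_
  obtain ⟨ℱ, hℱ, hfin, hKℱ⟩ := hK.vLower.elim_finite_subcover_sUnion h.1
    (h.2.1.symm ▸ subset_univ _)
  obtain ⟨U, hU, hne, hKU, hUW⟩ := exists_isOpen_ne_univ_vLower_subset hnc hK
    (isOpen_sUnion fun W hW => h.1 W (hℱ hW)) hKℱ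
  exact ⟨U, ⟨hU, hne, ℱ, hℱ, hfin, hUW⟩, hKU⟩

theorem IsNontrivialOpenCover.iUnion_pullSelection {ι Y : Type*} [TopologicalSpace Y]
    {S : Set (Set Y) → ι → Set (Set Y)} {b : ℕ → Set (Set Y)} {F : ℕ → Set ι}
    (hb : ∀ n, IsNontrivialOpenCover Y (b n)) (hS : ∀ n, ∀ u ∈ F n, S (b n) u ⊆ b n)
    (hc : ∀ y, ∃ n, ∃ u ∈ F n, ∃ W ∈ S (b n) u, y ∈ W) :
    IsNontrivialOpenCover Y (⋃ n, pullSelection S (b n) (F n)) := by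
  have hmem : ∀ W ∈ ⋃ n, pullSelection S (b n) (F n), ∃ n, W ∈ b n := fun W hW => by
    simp only [pullSelection, mem_iUnion] at hW
    obtain ⟨n, u, hu, hW⟩ := hW
    exact ⟨n, hS n u hu hW⟩
  refine ⟨fun W hW => ?_, eq_univ_of_forall fun y => ?_, fun hW => ?_⟩
  · obtain ⟨n, hn⟩ := hmem W hW
    exact (hb n).1 W hn
  · obtain ⟨n, u, hu, W, hW, hy⟩ := hc y
    exact ⟨W, mem_iUnion.2 ⟨n, mem_iUnion₂.2 ⟨u, hu, hW⟩⟩, hy⟩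
  · obtain ⟨n, hn⟩ := hmem _ hW
    exact (hb n).2.2 hn

theorem leTwoFin_kCovers_kCovers_KHyper [T1Space X] [Nonempty X]
    (hnc : ¬ IsCompact (univ : Set X)) :
    LeTwoFin (kCovers X) (kCovers X) (kCovers (KHyper X)) (kCovers (KHyper X)) := by
  have hex : ∀ (𝒲 : Set (Set (KHyper X))) (U : Set X), ∃ W, U ∈ lowerRefinement 𝒲 →
      W ∈ 𝒲 ∧ vLower X U ⊆ W := fun 𝒲 U => by
    by_cases hU : U ∈ lowerRefinement 𝒲
    · obtain ⟨W, hW⟩ := hU.2.2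
      exact ⟨W, fun _ => hW⟩
    · exact ⟨∅, fun h => absurd h hU⟩
  choose w hw using hex
  refine leTwoFin_of_translation lowerRefinement (fun 𝒲 U => {w 𝒲 U})
    (fun _ h => isKCover_lowerRefinement hnc h)
    (fun 𝒲 _ U hU => ⟨singleton_subset_iff.2 (hw 𝒲 U hU).1, finite_singleton _⟩)
    fun b F hb hF hC => ?_
  have hcov := IsKCover.image_vLower hnc hC
  have hpull : ∀ 𝒦 : Set (KHyper X), IsCompact 𝒦 → 𝒦 ≠ univ →
      ∃ n, ∃ U ∈ F n, 𝒦 ⊆ w (b n) U := fun 𝒦 h𝒦 hne => by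
    obtain ⟨_, ⟨U, hU, rfl⟩, hsub⟩ := hcov.2 𝒦 h𝒦 hne
    obtain ⟨n, hn⟩ := mem_iUnion.1 hU
    exact ⟨n, U, hn, hsub.trans (hw _ U (hF n hn)).2⟩
  refine ⟨IsNontrivialOpenCover.iUnion_pullSelection (fun n => (hb n).1)
    (fun n U hU => singleton_subset_iff.2 (hw _ U (hF n hU)).1) fun K => ?_, fun 𝒦 h𝒦 hne => ?_⟩
  · obtain ⟨U, hU, hKU⟩ := hC.exists_mem_vLower hnc K
    obtain ⟨n, hn⟩ := mem_iUnion.1 hU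
    exact ⟨n, U, hn, _, rfl, (hw _ U (hF n hn)).2 hKU⟩
  · obtain ⟨n, U, hU, hsub⟩ := hpull 𝒦 h𝒦 hne
    exact ⟨_, mem_iUnion.2 ⟨n, mem_iUnion₂.2 ⟨U, hU, rfl⟩⟩, hsub⟩

theorem leTwoFin_kCovers_openCovers_KHyper [T1Space X] [Nonempty X]
    (hnc : ¬ IsCompact (univ : Set X)) :
    LeTwoFin (kCovers X) (kCovers X) (openCovers (KHyper X)) (openCovers (KHyper X)) := by
  have hex : ∀ (𝒲 : Set (Set (KHyper X))) (U : Set X), ∃ ℱ, U ∈ lowerFiniteRefinement 𝒲 →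
      ℱ ⊆ 𝒲 ∧ ℱ.Finite ∧ vLower X U ⊆ ⋃₀ ℱ := fun 𝒲 U => by
    by_cases hU : U ∈ lowerFiniteRefinement 𝒲
    · obtain ⟨ℱ, hℱ⟩ := hU.2.2
      exact ⟨ℱ, fun _ => hℱ⟩
    · exact ⟨∅, fun h => absurd h hU⟩
  choose w hw using hex
  refine leTwoFin_of_translation lowerFiniteRefinement w
    (fun _ h => isKCover_lowerFiniteRefinement hnc h)
    (fun 𝒲 _ U hU => ⟨(hw 𝒲 U hU).1, (hw 𝒲 U hU).2.1⟩) fun b F hb hF hC => ?_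
  refine IsNontrivialOpenCover.iUnion_pullSelection hb (fun n U hU => (hw _ U (hF n hU)).1)
    fun K => ?_
  obtain ⟨U, hU, hKU⟩ := IsKCover.exists_mem_vLower hnc hC K
  obtain ⟨n, hn⟩ := mem_iUnion.1 hU
  obtain ⟨W, hW, hKW⟩ := (hw _ U (hF n hn)).2.2 hKU
  exact ⟨n, U, hn, W, hW, hKW⟩

end Covers

/-- For any infinite, non-compact Hausdorff space `X`:
`G_fin(K_X,K_X) ≡ G_fin(K_{𝕂(X)},K_{𝕂(X)}) ≡ G_fin(O_{𝕂(X)},O_{𝕂(X)})`. -/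
theorem statement15 {X : Type*} [TopologicalSpace X] [T2Space X] [Infinite X]
    (hnc : ¬ IsCompact (Set.univ : Set X)) :
    EquivFin (kCovers X) (kCovers X)
      (kCovers (KHyper X)) (kCovers (KHyper X)) ∧
    EquivFin (kCovers (KHyper X)) (kCovers (KHyper X))
      (openCovers (KHyper X)) (openCovers (KHyper X)) := by
  have hX := EquivFin.of_leTwoFin (leTwoFin_kCovers_kCovers_KHyper hnc)
    (leTwoFin_kCovers (fun _ h => h.image_vLower hnc) fun _ h => h.1.2.1)
  exact ⟨hX, hX.symm.trans <| .of_leTwoFin (leTwoFin_kCovers_openCovers_KHyper hnc)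
    (leTwoFin_kCovers (fun _ h => (h.image_vLower hnc).1) fun _ h => h.2.1)⟩
end
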